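/- Let τ > 0, and let m ≤ q, n ≤ p be nonnegative integers with N = 0 and p = q, and a ∈ ℂ^p, b ∈ ℂ^q with μ = 0, Re(ν) < 0, and λ♯ < λ♭; fix c ∈ (λ♯, λ♭) ∩ ℝ. Then for every w ∈ ℂ with |Im(w)| < −Re(ν)/(4τ) the integral defining K^{m,n}_{p,p}(a;b | e^{2πw}; τ, 0) converges absolutely, and the function w ↦ K^{m,n}_{p,p}(a;b | e^{2πw}; τ, 0) is analytic on the horizontal strip {w ∈ ℂ : |Im(w)| < −Re(ν)/(4τ)}. -/

import Mathlib

open Complex Filter MeasureTheory Set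

noncomputable section

/-- The digamma function ψ = Γ'/Γ. -/
def digammaC (z : ℂ) : ℂ := deriv Complex.Gamma z / Complex.Gamma z

/-- The gamma modular form C(τ). -/
def gammaModC (τ : ℂ) : ℂ :=
  limUnder atTop fun M : ℕ =>
    (∑ k ∈ Finset.Ico 1 M, digammaC (k * τ)) + digammaC (M * τ) / 2
      - (1 / τ) * Complex.log (Complex.Gamma (M * τ) / (Real.sqrt (2 * Real.pi) : ℂ))

/-- The gamma modular form D(τ). -/
def gammaModD (τ : ℂ) : ℂ :=
  limUnder atTop fun M : ℕ =>
    (∑ k ∈ Finset.Ico 1 M, deriv digammaC (k * τ)) + deriv digammaC (M * τ) / 2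
      - (1 / τ) * digammaC (M * τ)

def aBarnes (τ : ℂ) : ℂ :=
  -(Real.eulerMascheroniConstant : ℂ) * τ + (τ / 2) * Complex.log (2 * Real.pi * τ)
    + (1 / 2) * Complex.log τ - τ * gammaModC τ

def bBarnes (τ : ℂ) : ℂ :=
  -(Real.pi : ℂ) ^ 2 * τ ^ 2 / 6 - τ * Complex.log τ - τ ^ 2 * gammaModD τ

/-- The Barnes double gamma function `G(z;τ)`, via its Weierstrass product. -/
def barnesG (z τ : ℂ) : ℂ :=
  z / τ * Complex.exp (aBarnes τ * z / τ + bBarnes τ * z ^ 2 / (2 * τ)) *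
    ∏' mn : ℕ × ℕ,
      if mn = (0, 0) then 1
      else (1 + z / (mn.1 * τ + mn.2)) *
        Complex.exp (-(z / (mn.1 * τ + mn.2)) + z ^ 2 / (2 * ((mn.1 : ℂ) * τ + (mn.2 : ℂ)) ^ 2))

/-- The ratio of Barnes double gamma functions `𝒢^{m,n}_{p,q}(a;b | s;τ)`. -/
def calG (m n : ℕ) {p q : ℕ} (a : Fin p → ℂ) (b : Fin q → ℂ) (s τ : ℂ) : ℂ :=
  ((∏ j : Fin q, if (j : ℕ) < m then barnesG (b j - s) τ else 1) *
      ∏ j : Fin p, if (j : ℕ) < n then barnesG (1 + τ - a j + s) τ else 1) /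
    ((∏ j : Fin q, if m ≤ (j : ℕ) then barnesG (1 + τ - b j + s) τ else 1) *
      ∏ j : Fin p, if n ≤ (j : ℕ) then barnesG (a j - s) τ else 1)

/-- `N = 2(m+n) - p - q`. -/
def paramN (m n p q : ℕ) : ℤ := 2 * (m + n) - p - q

/-- `ν = Σ a_j - Σ b_j`. -/
def paramNu {p q : ℕ} (a : Fin p → ℂ) (b : Fin q → ℂ) : ℂ := (∑ j, a j) - ∑ j, b j

/-- `μ = Σ_{j≤n} a_j - Σ_{j>n} a_j + Σ_{j≤m} b_j - Σ_{j>m} b_j`. -/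
def paramMu (m n : ℕ) {p q : ℕ} (a : Fin p → ℂ) (b : Fin q → ℂ) : ℂ :=
  (∑ j : Fin p, if (j : ℕ) < n then a j else 0) - (∑ j : Fin p, if n ≤ (j : ℕ) then a j else 0)
    + (∑ j : Fin q, if (j : ℕ) < m then b j else 0) - ∑ j : Fin q, if m ≤ (j : ℕ) then b j else 0

/-- `ξ = Σ_{j≤n} a_j² - Σ_{j>n} a_j² + Σ_{j≤m} b_j² - Σ_{j>m} b_j²`. -/
def paramXi (m n : ℕ) {p q : ℕ} (a : Fin p → ℂ) (b : Fin q → ℂ) : ℂ :=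
  (∑ j : Fin p, if (j : ℕ) < n then a j ^ 2 else 0)
    - (∑ j : Fin p, if n ≤ (j : ℕ) then a j ^ 2 else 0)
    + (∑ j : Fin q, if (j : ℕ) < m then b j ^ 2 else 0)
    - ∑ j : Fin q, if m ≤ (j : ℕ) then b j ^ 2 else 0

/-- The Meijer–Barnes `K`-function with vertical contour `c + iℝ`, at `z = e^{2πw}`:
`K^{m,n}_{p,q}(a;b | e^{2πw}; τ, α) = (1/(2πi)) ∫_{c+iℝ} 𝒢(s) e^{(πα/τ)s²} e^{-2πws} ds`. -/
def Kfun (m n : ℕ) {p q : ℕ} (a : Fin p → ℂ) (b : Fin q → ℂ) (τ α : ℂ) (c : ℝ) (w : ℂ) : ℂ :=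
  1 / (2 * Real.pi * Complex.I) *
    ∫ t : ℝ, (calG m n a b (c + t * Complex.I) τ *
      Complex.exp ((Real.pi : ℂ) * α / τ * (c + t * Complex.I) ^ 2) *
      Complex.exp (-(2 * Real.pi * w * (c + t * Complex.I)))) * Complex.I

/-- The reciprocal `1 / (mτ + n)` of a lattice point, equal to `0` at the origin. -/
def latticeInv (τ : ℝ) (k : ℕ × ℕ) : ℝ := ((k.1 : ℝ) * τ + k.2)⁻¹

/-- The elementary factor `(1 + u) exp(-u + u²/2)` of genus two. -/
def barnesFactor (u : ℂ) : ℂ := (1 + u) * Complex.exp (-u + u ^ 2 / 2)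

lemma latticeInv_nonneg {τ : ℝ} (hτ : 0 < τ) (k : ℕ × ℕ) : 0 ≤ latticeInv τ k := by
  unfold latticeInv; positivity

lemma latticeInv_zero (τ : ℝ) : latticeInv τ (0, 0) = 0 := by simp [latticeInv]

lemma summable_latticeInv_pow {τ : ℝ} (hτ : 0 < τ) :
    Summable fun k : ℕ × ℕ => latticeInv τ k ^ 3 := by
  have h1 : Summable fun n : ℕ => ((n : ℝ) + 1) ^ (-(3 / 2 : ℝ)) := by
    have h := (Real.summable_nat_rpow (p := -(3 / 2 : ℝ))).2 (by norm_num)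
    simpa using (summable_nat_add_iff 1).2 h
  have h2 := h1.mul_of_nonneg h1 (fun n => by positivity) (fun n => by positivity)
  set ρ := min τ 1 with hρ
  have hρ0 : 0 < ρ := lt_min hτ one_pos
  refine Summable.of_nonneg_of_le (fun k => pow_nonneg (latticeInv_nonneg hτ k) 3) (fun k => ?_)
    (h2.mul_left ((2 / ρ) ^ 3))
  obtain ⟨m, n⟩ := k
  have hm : (0 : ℝ) ≤ m := m.cast_nonneg
  have hn : (0 : ℝ) ≤ n := n.cast_nonneg
  by_cases h0 : m = 0 ∧ n = 0
  · obtain ⟨rfl, rfl⟩ := h0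
    rw [latticeInv_zero, zero_pow three_ne_zero]
    positivity
  have hmn : (1 : ℝ) ≤ m + n := by
    have : 1 ≤ m + n := by omega
    exact_mod_cast this
  have hω : ρ / 2 * (((m : ℝ) + 1) * (n + 1)) ^ (1 / 2 : ℝ) ≤ m * τ + n := by
    have e1 : (((m : ℝ) + 1) * (n + 1)) ^ (1 / 2 : ℝ) ≤ m + n + 1 := by
      rw [← Real.sqrt_eq_rpow]
      apply Real.sqrt_le_iff.2 ⟨by positivity, by nlinarith⟩
    have e2 : ρ * (m + n) ≤ m * τ + n := by
      have := min_le_left τ 1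
      have := min_le_right τ 1
      nlinarith
    nlinarith
  have hpos : 0 < ρ / 2 * (((m : ℝ) + 1) * (n + 1)) ^ (1 / 2 : ℝ) := by positivity
  have h3 : latticeInv τ (m, n) ≤ (ρ / 2 * (((m : ℝ) + 1) * (n + 1)) ^ (1 / 2 : ℝ))⁻¹ := by
    unfold latticeInv
    exact inv_anti₀ hpos hω
  refine (pow_le_pow_left₀ (latticeInv_nonneg hτ _) h3 3).trans (le_of_eq ?_)
  have hp : (0 : ℝ) ≤ (m + 1) * (n + 1) := by positivity
  rw [← Real.mul_rpow (by positivity) (by positivity), mul_inv, mul_pow, inv_div,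
    Real.rpow_neg hp, inv_pow, ← Real.rpow_natCast (_ ^ (1 / 2 : ℝ)), ← Real.rpow_mul hp]
  norm_num

lemma hasDerivAt_barnesFactor (u : ℂ) :
    HasDerivAt barnesFactor (u ^ 2 * Complex.exp (-u + u ^ 2 / 2)) u := by
  have h1 : HasDerivAt (fun u : ℂ => 1 + u) 1 u := (hasDerivAt_id u).const_add 1
  have h2 : HasDerivAt (fun u : ℂ => -u + u ^ 2 / 2) (-1 + u) u := by
    have := (hasDerivAt_id u).neg.add (((hasDerivAt_id u).pow 2).div_const 2)
    refine this.congr_deriv ?_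
    simp
  refine (h1.mul h2.cexp).congr_deriv ?_
  ring

lemma differentiable_barnesFactor : Differentiable ℂ barnesFactor :=
  fun u => (hasDerivAt_barnesFactor u).differentiableAt

lemma norm_barnesFactor_sub_one_le (u : ℂ) :
    ‖barnesFactor u - 1‖ ≤ ‖u‖ ^ 3 * Real.exp (‖u‖ + ‖u‖ ^ 2 / 2) := by
  have h := (convex_closedBall (0 : ℂ) ‖u‖).norm_image_sub_le_of_norm_hasDerivWithin_le
    (f := barnesFactor) (C := ‖u‖ ^ 2 * Real.exp (‖u‖ + ‖u‖ ^ 2 / 2))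
    (fun x _ => (hasDerivAt_barnesFactor x).hasDerivWithinAt)
    (fun x hx => by
      have hx' : ‖x‖ ≤ ‖u‖ := by simpa using hx
      rw [norm_mul, norm_pow, Complex.norm_exp]
      gcongr
      calc (-x + x ^ 2 / 2).re ≤ ‖-x + x ^ 2 / 2‖ := Complex.re_le_norm _
        _ ≤ ‖-x‖ + ‖x ^ 2 / 2‖ := norm_add_le _ _
        _ ≤ ‖u‖ + ‖u‖ ^ 2 / 2 := by
          rw [norm_neg, norm_div, norm_pow, Complex.norm_ofNat]
          gcongr)
    (x := 0) (y := u) (by simp) (by simp)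
  have h0 : barnesFactor 0 = 1 := by simp [barnesFactor]
  rw [h0, sub_zero] at h
  exact h.trans (le_of_eq (by ring))

lemma barnesG_eq (z : ℂ) (τ : ℝ) :
    barnesG z τ = z / τ * Complex.exp (aBarnes τ * z / τ + bBarnes τ * z ^ 2 / (2 * τ)) *
      ∏' k : ℕ × ℕ, barnesFactor (latticeInv τ k * z) := by
  unfold barnesG
  congr 1
  refine tprod_congr fun k => ?_
  split_ifs with h
  · rw [h, latticeInv_zero]
    simp [barnesFactor]
  · unfold barnesFactor latticeInv
    push_cast
    rw [div_eq_inv_mul z, div_eq_mul_inv (z ^ 2), mul_inv, ← inv_pow]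
    congr 2
    ring

lemma multipliableLocallyUniformlyOn_barnesFactor {τ : ℝ} (hτ : 0 < τ) (R : ℝ) :
    MultipliableLocallyUniformlyOn (fun (k : ℕ × ℕ) (z : ℂ) => barnesFactor (latticeInv τ k * z))
      (Metric.ball 0 R) := by
  obtain ⟨M, hM⟩ : ∃ M, ∀ k, latticeInv τ k ≤ M := by
    refine ⟨(min τ 1)⁻¹, fun k => ?_⟩
    have hρ0 : 0 < min τ 1 := lt_min hτ one_pos
    obtain ⟨m, n⟩ := k
    by_cases h0 : m = 0 ∧ n = 0
    · obtain ⟨rfl, rfl⟩ := h0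
      rw [latticeInv_zero]
      positivity
    apply inv_anti₀ hρ0
    have hm : (0 : ℝ) ≤ m := m.cast_nonneg
    have hn : (0 : ℝ) ≤ n := n.cast_nonneg
    have hmn : (1 : ℝ) ≤ m + n := by
      have : 1 ≤ m + n := by omega
      exact_mod_cast this
    have := min_le_left τ 1
    have := min_le_right τ 1
    simp only
    nlinarith
  have hu := (summable_latticeInv_pow hτ).mul_right
    (R ^ 3 * Real.exp (M * R + (M * R) ^ 2 / 2))
  have := Summable.multipliableLocallyUniformlyOn_one_add
    (f := fun (k : ℕ × ℕ) (z : ℂ) => barnesFactor (latticeInv τ k * z) - 1)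
    (K := Metric.ball (0 : ℂ) R) Metric.isOpen_ball hu (Eventually.of_forall fun k z hz => ?_)
    (fun k => ((differentiable_barnesFactor.comp (differentiable_id.const_mul _)).sub_const
      1).continuous.continuousOn)
  · simpa using this
  · have hz' : ‖z‖ ≤ R := by
      have : ‖z‖ < R := by simpa using hz
      exact this.le
    have hR : 0 ≤ R := (norm_nonneg z).trans hz'
    have hv := latticeInv_nonneg hτ k
    have hn : ‖(latticeInv τ k : ℂ) * z‖ = latticeInv τ k * ‖z‖ := by
      rw [norm_mul, Complex.norm_real, Real.norm_of_nonneg hv]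
    refine (norm_barnesFactor_sub_one_le _).trans ?_
    rw [hn, mul_pow, mul_assoc]
    have : latticeInv τ k * ‖z‖ ≤ M * R := mul_le_mul (hM k) hz' (norm_nonneg _) (hv.trans (hM k))
    gcongr

lemma differentiable_tprod_barnesFactor {τ : ℝ} (hτ : 0 < τ) :
    Differentiable ℂ fun z : ℂ => ∏' k : ℕ × ℕ, barnesFactor (latticeInv τ k * z) := by
  intro z
  have h := (multipliableLocallyUniformlyOn_barnesFactor hτ
    (‖z‖ + 1)).hasProdLocallyUniformlyOn.differentiableOn
    (.of_forall fun s => by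
      simpa [Finset.prod_fn] using DifferentiableOn.finsetProd (fun k _ =>
        (differentiable_barnesFactor.comp (differentiable_id.const_mul _)).differentiableOn))
    Metric.isOpen_ball
  exact h.differentiableAt (Metric.isOpen_ball.mem_nhds (by simp))

lemma differentiable_barnesG {τ : ℝ} (hτ : 0 < τ) : Differentiable ℂ fun z => barnesG z τ := by
  simp_rw [barnesG_eq]
  exact (by fun_prop : Differentiable ℂ fun z : ℂ => z / (τ : ℂ) *
    Complex.exp (aBarnes τ * z / τ + bBarnes τ * z ^ 2 / (2 * τ))).mul
    (differentiable_tprod_barnesFactor hτ)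

lemma one_add_mul_mem_slitPlane {v : ℝ} (hv : 0 ≤ v) {z : ℂ} (hz : z ∈ slitPlane) :
    1 + v * z ∈ slitPlane := by
  rcases hv.eq_or_lt with rfl | hv
  · simp
  rw [Complex.mem_slitPlane_iff] at hz ⊢
  rcases hz with h | h
  · left
    simp
    positivity
  · right
    simpa using ⟨hv.ne', h⟩

lemma barnesFactor_ne_zero {τ : ℝ} (hτ : 0 < τ) {z : ℂ} (hz : z ∈ slitPlane) (k : ℕ × ℕ) :
    barnesFactor (latticeInv τ k * z) ≠ 0 :=
  mul_ne_zero (slitPlane_ne_zero (one_add_mul_mem_slitPlane (latticeInv_nonneg hτ k) hz))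
    (Complex.exp_ne_zero _)

lemma tprod_barnesFactor_ne_zero {τ : ℝ} (hτ : 0 < τ) {z : ℂ} (hz : z ∈ slitPlane) :
    ∏' k : ℕ × ℕ, barnesFactor (latticeInv τ k * z) ≠ 0 := by
  have hv3 := summable_latticeInv_pow hτ
  have h := tprod_one_add_ne_zero_of_summable
    (f := fun k : ℕ × ℕ => barnesFactor (latticeInv τ k * z) - 1)
    (fun k => by simpa using barnesFactor_ne_zero hτ hz k) ?_
  · simpa using h
  have ht : Tendsto (fun k => latticeInv τ k ^ 3) cofinite (nhds 0) :=
    hv3.tendsto_cofinite_zero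
  have hev : ∀ᶠ k in cofinite, latticeInv τ k ≤ 1 := by
    filter_upwards [ht.eventually_lt_const one_pos] with k hk
    by_contra hcon
    exact absurd hk (not_lt.2 (one_le_pow₀ (not_le.1 hcon).le))
  refine Summable.of_norm_bounded_eventually
    (hv3.mul_right (‖z‖ ^ 3 * Real.exp (‖z‖ + ‖z‖ ^ 2 / 2))) ?_
  filter_upwards [hev] with k hk
  have hv := latticeInv_nonneg hτ k
  have hn : ‖(latticeInv τ k : ℂ) * z‖ = latticeInv τ k * ‖z‖ := by
    rw [norm_mul, Complex.norm_real, Real.norm_of_nonneg hv]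
  rw [norm_norm]
  refine (norm_barnesFactor_sub_one_le _).trans ?_
  rw [hn, mul_pow, mul_assoc]
  have : latticeInv τ k * ‖z‖ ≤ ‖z‖ := mul_le_of_le_one_left (norm_nonneg _) hk
  gcongr

lemma barnesG_ne_zero {τ : ℝ} (hτ : 0 < τ) {z : ℂ} (hz : z ∈ slitPlane) : barnesG z τ ≠ 0 := by
  rw [barnesG_eq]
  have h0 := slitPlane_ne_zero hz
  have hτ' : (τ : ℂ) ≠ 0 := by exact_mod_cast hτ.ne'
  exact mul_ne_zero (mul_ne_zero (div_ne_zero h0 hτ') (Complex.exp_ne_zero _))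
    (tprod_barnesFactor_ne_zero hτ hz)

lemma half_le_norm_one_add {v : ℝ} {z : ℂ} (hz : |z.re| ≤ |z.im|) :
    1 / 2 ≤ ‖1 + (v : ℂ) * z‖ := by
  have h : z.re ^ 2 ≤ z.im ^ 2 := sq_le_sq.2 hz
  have h2 : (1 / 2 : ℝ) ^ 2 ≤ ‖1 + (v : ℂ) * z‖ ^ 2 := by
    rw [← Complex.normSq_eq_norm_sq, Complex.normSq_apply]
    simp
    nlinarith [sq_nonneg (1 + 2 * v * z.re), mul_le_mul_of_nonneg_left h (sq_nonneg v)]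
  exact (pow_le_pow_iff_left₀ (by norm_num) (norm_nonneg _) two_ne_zero).1 h2

lemma summable_logDeriv_barnesG {τ : ℝ} (hτ : 0 < τ) {z : ℂ} (hz : |z.re| ≤ |z.im|) :
    Summable fun k => (latticeInv τ k : ℂ) ^ 3 * z ^ 2 / (1 + latticeInv τ k * z) := by
  refine Summable.of_norm_bounded ((summable_latticeInv_pow hτ).mul_right (2 * ‖z‖ ^ 2))
    fun k => ?_
  have hv := latticeInv_nonneg hτ k
  have h12 := half_le_norm_one_add (v := latticeInv τ k) hz
  rw [norm_div, norm_mul, norm_pow, norm_pow, Complex.norm_real, Real.norm_of_nonneg hv,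
    div_le_iff₀ (by linarith)]
  have : 0 ≤ latticeInv τ k ^ 3 * ‖z‖ ^ 2 := by positivity
  nlinarith

/-- The logarithmic derivative of the Barnes double gamma function, as a partial fraction series. -/
lemma logDeriv_barnesG {τ : ℝ} (hτ : 0 < τ) {z : ℂ} (hz : |z.re| ≤ |z.im|) (him : z.im ≠ 0) :
    logDeriv (fun z => barnesG z τ) z = 1 / z + (aBarnes τ / τ + bBarnes τ / τ * z) +
      ∑' k, (latticeInv τ k : ℂ) ^ 3 * z ^ 2 / (1 + latticeInv τ k * z) := by
  have hs : z ∈ slitPlane := Complex.mem_slitPlane_iff.2 (Or.inr him)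
  have h0 := slitPlane_ne_zero hs
  have hτ' : (τ : ℂ) ≠ 0 := by exact_mod_cast hτ.ne'
  have hfac : ∀ k, logDeriv (fun z : ℂ => barnesFactor (latticeInv τ k * z)) z =
      (latticeInv τ k : ℂ) ^ 3 * z ^ 2 / (1 + latticeInv τ k * z) := by
    intro k
    have hne : 1 + (latticeInv τ k : ℂ) * z ≠ 0 :=
      slitPlane_ne_zero (one_add_mul_mem_slitPlane (latticeInv_nonneg hτ k) hs)
    have hd := (hasDerivAt_barnesFactor (latticeInv τ k * z)).comp z
      ((hasDerivAt_id z).const_mul (latticeInv τ k : ℂ))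
    have hd' : deriv (fun z : ℂ => barnesFactor (latticeInv τ k * z)) z = _ := hd.deriv
    rw [logDeriv_apply, hd']
    unfold barnesFactor
    simp only [mul_one]
    have := Complex.exp_ne_zero (-(latticeInv τ k * z) + (latticeInv τ k * z : ℂ) ^ 2 / 2)
    field_simp
  have hsum : Summable fun k => logDeriv (fun z : ℂ => barnesFactor (latticeInv τ k * z)) z := by
    simp_rw [hfac]
    exact summable_logDeriv_barnesG hτ hz
  have hprod : logDeriv (fun z : ℂ => ∏' k : ℕ × ℕ, barnesFactor (latticeInv τ k * z)) z =
      ∑' k, logDeriv (fun z : ℂ => barnesFactor (latticeInv τ k * z)) z :=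
    logDeriv_tprod_eq_tsum (s := Metric.ball 0 (‖z‖ + 1)) Metric.isOpen_ball (by simp)
      (fun k => barnesFactor_ne_zero hτ hs k)
      (fun k => (differentiable_barnesFactor.comp
        (differentiable_id.const_mul _)).differentiableOn) hsum
      (multipliableLocallyUniformlyOn_barnesFactor hτ _) (tprod_barnesFactor_ne_zero hτ hs)
  have hE : Differentiable ℂ fun z : ℂ =>
      Complex.exp (aBarnes τ * z / τ + bBarnes τ * z ^ 2 / (2 * τ)) := by fun_prop
  have hD : Differentiable ℂ fun z : ℂ => z / (τ : ℂ) := by fun_prop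
  have hE0 := Complex.exp_ne_zero (aBarnes τ * z / τ + bBarnes τ * z ^ 2 / (2 * τ))
  have hexp : (fun z => barnesG z τ) = fun z : ℂ => z / (τ : ℂ) *
      Complex.exp (aBarnes τ * z / τ + bBarnes τ * z ^ 2 / (2 * τ)) *
      ∏' k : ℕ × ℕ, barnesFactor (latticeInv τ k * z) := funext fun z => barnesG_eq z τ
  have e1 := logDeriv_mul (f := fun z : ℂ => z / (τ : ℂ) *
      Complex.exp (aBarnes τ * z / τ + bBarnes τ * z ^ 2 / (2 * τ)))
    (g := fun z : ℂ => ∏' k : ℕ × ℕ, barnesFactor (latticeInv τ k * z)) z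
    (mul_ne_zero (div_ne_zero h0 hτ') hE0)
    (tprod_barnesFactor_ne_zero hτ hs) ((hD z).mul (hE z)) (differentiable_tprod_barnesFactor hτ z)
  have e2 := logDeriv_mul (f := fun z : ℂ => z / (τ : ℂ)) (g := fun z : ℂ =>
      Complex.exp (aBarnes τ * z / τ + bBarnes τ * z ^ 2 / (2 * τ))) z
    (div_ne_zero h0 hτ') hE0 (hD z) (hE z)
  rw [hexp, e1, hprod, e2]
  simp_rw [hfac]
  congr 2
  · rw [logDeriv_apply]
    have : HasDerivAt (fun z : ℂ => z / (τ : ℂ)) (1 / τ) z := (hasDerivAt_id z).div_const _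
    rw [this.deriv]
    field_simp
  · rw [logDeriv_apply]
    have h1 : HasDerivAt (fun z : ℂ => aBarnes τ * z / τ + bBarnes τ * z ^ 2 / (2 * τ))
        (aBarnes τ / τ + bBarnes τ / τ * z) z := by
      have := (((hasDerivAt_id z).const_mul (aBarnes τ)).div_const (τ : ℂ)).add
        ((((hasDerivAt_id z).pow 2).const_mul (bBarnes τ)).div_const (2 * (τ : ℂ)))
      refine this.congr_deriv ?_
      simp
      field_simp
    rw [h1.cexp.deriv]
    field_simp

lemma tsum_sub_succ_eq {f : ℕ → ℝ} {l : ℝ} (hs : Summable fun n => f (n + 1) - f n)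
    (ht : Tendsto f atTop (nhds l)) : ∑' n, (f (n + 1) - f n) = l - f 0 := by
  refine tendsto_nhds_unique hs.hasSum.tendsto_sum_nat ?_
  simp_rw [Finset.sum_range_sub]
  exact ht.sub_const _

lemma abs_second_difference_sub_le {f f₁ f₂ f₃ : ℝ → ℝ} (h₁ : ∀ x, HasDerivAt f (f₁ x) x)
    (h₂ : ∀ x, HasDerivAt f₁ (f₂ x) x) (h₃ : ∀ x, HasDerivAt f₂ (f₃ x) x) {x M τ : ℝ}
    (hτ : 0 ≤ τ) (hM : ∀ ξ, x ≤ ξ → |f₃ ξ| ≤ M) :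
    |f (x + τ + 1) - f (x + τ) - f (x + 1) + f x - τ * f₂ x| ≤ τ * (1 + τ) * M := by
  have hM0 : 0 ≤ M := (abs_nonneg _).trans (hM x le_rfl)
  have s1 : ∀ ξ, x ≤ ξ → |f₂ ξ - f₂ x| ≤ M * (ξ - x) := by
    intro ξ hξ
    have := (convex_Icc x ξ).norm_image_sub_le_of_norm_hasDerivWithin_le
      (fun u _ => (h₃ u).hasDerivWithinAt) (fun u hu => hM u hu.1)
      (left_mem_Icc.2 hξ) (right_mem_Icc.2 hξ)
    rwa [Real.norm_eq_abs, Real.norm_eq_abs, abs_of_nonneg (sub_nonneg.2 hξ)] at this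
  have s2 : ∀ u ∈ Icc x (x + τ), |f₁ (u + 1) - f₁ u - f₂ x| ≤ M * (1 + τ) := by
    intro u hu
    have hd : ∀ v, HasDerivAt (fun v => f₁ v - f₂ x * v) (f₂ v - f₂ x) v := fun v =>
      ((h₂ v).sub ((hasDerivAt_id v).const_mul (f₂ x))).congr_deriv (by simp)
    have := (convex_Icc u (u + 1)).norm_image_sub_le_of_norm_hasDerivWithin_le
      (C := M * (1 + τ))
      (fun v _ => (hd v).hasDerivWithinAt) (fun v hv => (s1 v (hu.1.trans hv.1)).trans
        (mul_le_mul_of_nonneg_left (by linarith [hv.2, hu.2]) hM0))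
      (left_mem_Icc.2 (by linarith)) (right_mem_Icc.2 (by linarith))
    rw [Real.norm_eq_abs, Real.norm_eq_abs] at this
    simp only [add_sub_cancel_left, abs_one, mul_one] at this
    convert this using 2
    ring
  have hd : ∀ u, HasDerivAt (fun u => f (u + 1) - f u - f₂ x * u) (f₁ (u + 1) - f₁ u - f₂ x) u :=
    fun u => ((((h₁ (u + 1)).comp_add_const u 1).sub (h₁ u)).sub
      ((hasDerivAt_id u).const_mul (f₂ x))).congr_deriv (by simp)
  have := (convex_Icc x (x + τ)).norm_image_sub_le_of_norm_hasDerivWithin_le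
    (fun u _ => (hd u).hasDerivWithinAt) s2
    (left_mem_Icc.2 (by linarith)) (right_mem_Icc.2 (by linarith))
  rw [Real.norm_eq_abs, Real.norm_eq_abs, add_sub_cancel_left, abs_of_nonneg hτ] at this
  calc _ = |f (x + τ + 1) - f (x + τ) - f₂ x * (x + τ) - (f (x + 1) - f x - f₂ x * x)| := by
        congr 1; ring
    _ ≤ M * (1 + τ) * τ := this
    _ = _ := by ring

lemma abs_arctan_second_difference_le {τ x y : ℝ} (hτ : 0 ≤ τ) (hx : 0 ≤ x) (hy : 0 < y) :
    |-(Real.arctan ((x + τ + 1) / y) - Real.arctan ((x + τ) / y) - Real.arctan ((x + 1) / y)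
      + Real.arctan (x / y)) / 2 - τ * (x * y / (x ^ 2 + y ^ 2) ^ 2)| ≤
      τ * (1 + τ) * (3 * y / (x ^ 2 + y ^ 2) ^ 2) := by
  have hp : ∀ ξ : ℝ, 0 < ξ ^ 2 + y ^ 2 := fun ξ => by positivity
  have h₁ : ∀ ξ, HasDerivAt (fun ξ => Real.arctan (ξ / y)) (y / (ξ ^ 2 + y ^ 2)) ξ := fun ξ => by
    refine ((hasDerivAt_id ξ).div_const y).arctan.congr_deriv ?_
    have := (hp ξ).ne'
    have h2 : 1 + (ξ / y) ^ 2 = (ξ ^ 2 + y ^ 2) / y ^ 2 := by field_simp; ring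
    simp only [id]
    rw [h2]
    field_simp
  have hq : ∀ ξ, HasDerivAt (fun ξ : ℝ => ξ ^ 2 + y ^ 2) (2 * ξ) ξ := fun ξ => by
    simpa using ((hasDerivAt_id ξ).pow 2).add_const (y ^ 2)
  have h₂ : ∀ ξ, HasDerivAt (fun ξ => y / (ξ ^ 2 + y ^ 2))
      (-(2 * (ξ * y / (ξ ^ 2 + y ^ 2) ^ 2))) ξ := fun ξ => by
    refine ((hasDerivAt_const ξ y).div (hq ξ) (hp ξ).ne').congr_deriv ?_
    ring
  have h₃ : ∀ ξ, HasDerivAt (fun ξ => -(2 * (ξ * y / (ξ ^ 2 + y ^ 2) ^ 2)))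
      (2 * y * (3 * ξ ^ 2 - y ^ 2) / (ξ ^ 2 + y ^ 2) ^ 3) ξ := fun ξ => by
    refine (((((hasDerivAt_id ξ).mul_const y).div ((hq ξ).pow 2)
      (pow_ne_zero 2 (hp ξ).ne')).const_mul 2).neg).congr_deriv ?_
    have := (hp ξ).ne'
    simp
    field_simp
    ring
  have hM : ∀ ξ, x ≤ ξ → |2 * y * (3 * ξ ^ 2 - y ^ 2) / (ξ ^ 2 + y ^ 2) ^ 3| ≤
      6 * y / (x ^ 2 + y ^ 2) ^ 2 := by
    intro ξ hξ
    have hξ2 : x ^ 2 ≤ ξ ^ 2 := by gcongr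
    have e1 : |3 * ξ ^ 2 - y ^ 2| ≤ 3 * (ξ ^ 2 + y ^ 2) :=
      abs_le.2 ⟨by nlinarith [sq_nonneg ξ, sq_nonneg y], by nlinarith [sq_nonneg ξ, sq_nonneg y]⟩
    rw [abs_div, abs_mul, abs_of_pos (by positivity : 0 < 2 * y),
      abs_of_pos (pow_pos (hp ξ) 3)]
    calc 2 * y * |3 * ξ ^ 2 - y ^ 2| / (ξ ^ 2 + y ^ 2) ^ 3
        ≤ 2 * y * (3 * (ξ ^ 2 + y ^ 2)) / (ξ ^ 2 + y ^ 2) ^ 3 := by gcongr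
      _ = 6 * y / (ξ ^ 2 + y ^ 2) ^ 2 := by
        have := (hp ξ).ne'
        field_simp
        ring
      _ ≤ _ := by gcongr
  have := abs_second_difference_sub_le h₁ h₂ h₃ hτ hM
  calc _ = |-(Real.arctan ((x + τ + 1) / y) - Real.arctan ((x + τ) / y) - Real.arctan ((x + 1) / y)
      + Real.arctan (x / y) - τ * -(2 * (x * y / (x ^ 2 + y ^ 2) ^ 2))) / 2| := by congr 1; ring
    _ = |Real.arctan ((x + τ + 1) / y) - Real.arctan ((x + τ) / y) - Real.arctan ((x + 1) / y)
      + Real.arctan (x / y) - τ * -(2 * (x * y / (x ^ 2 + y ^ 2) ^ 2))| / 2 := by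
        rw [abs_div, abs_neg, abs_two]
    _ ≤ τ * (1 + τ) * (6 * y / (x ^ 2 + y ^ 2) ^ 2) / 2 := by gcongr
    _ = _ := by ring

/-- The second difference along the lattice of `-arctan (· / y) / 2`. -/
def arctanDiff (τ y : ℝ) (k : ℕ × ℕ) : ℝ :=
  -(Real.arctan ((k.1 * τ + k.2 + τ + 1) / y) - Real.arctan ((k.1 * τ + k.2 + τ) / y)
    - Real.arctan ((k.1 * τ + k.2 + 1) / y) + Real.arctan ((k.1 * τ + k.2) / y)) / 2

lemma tendsto_arctan_add_div (c : ℝ) {y a : ℝ} (hy : 0 < y) (ha : 0 < a) :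
    Tendsto (fun n : ℕ => Real.arctan ((n * a + c) / y)) atTop (nhds (Real.pi / 2)) := by
  refine (Real.tendsto_arctan_atTop.mono_right nhdsWithin_le_nhds).comp ?_
  refine Tendsto.atTop_div_const hy (tendsto_atTop_add_const_right _ _ ?_)
  exact tendsto_natCast_atTop_atTop.atTop_mul_const ha

lemma tsum_arctanDiff {τ y : ℝ} (hτ : 0 < τ) (hy : 0 < y) (hs : Summable (arctanDiff τ y)) :
    ∑' k, arctanDiff τ y k = Real.pi / 4 := by
  rw [hs.tsum_prod]
  have inner : ∀ m : ℕ, ∑' n : ℕ, arctanDiff τ y (m, n) =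
      Real.arctan (((m + 1 : ℕ) : ℝ) * τ / y) / 2 - Real.arctan ((m : ℝ) * τ / y) / 2 := by
    intro m
    set B : ℕ → ℝ := fun n => -(Real.arctan ((n * 1 + (m * τ + τ)) / y)
      - Real.arctan ((n * 1 + m * τ) / y)) / 2 with hB
    have e : ∀ n, arctanDiff τ y (m, n) = B (n + 1) - B n := by
      intro n
      have e1 : (m : ℝ) * τ + n + τ + 1 = ((n + 1 : ℕ) : ℝ) * 1 + (m * τ + τ) := by push_cast; ring
      have e2 : (m : ℝ) * τ + n + τ = (n : ℝ) * 1 + (m * τ + τ) := by ring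
      have e3 : (m : ℝ) * τ + n + 1 = ((n + 1 : ℕ) : ℝ) * 1 + m * τ := by push_cast; ring
      have e4 : (m : ℝ) * τ + n = (n : ℝ) * 1 + m * τ := by ring
      simp only [arctanDiff, hB]
      rw [e1, e2, e3, e4]
      ring
    have hsm : Summable fun n => B (n + 1) - B n := by
      have := hs.prod_factor m
      simpa only [e] using this
    have ht : Tendsto B atTop (nhds (-(Real.pi / 2 - Real.pi / 2) / 2)) :=
      ((tendsto_arctan_add_div _ hy one_pos).sub (tendsto_arctan_add_div _ hy one_pos)).neg.div_const
        2
    simp_rw [e]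
    rw [tsum_sub_succ_eq hsm ht]
    simp only [hB, CharP.cast_eq_zero, zero_mul, zero_add]
    push_cast
    rw [add_mul, one_mul]
    ring
  have hsm := hs.prod
  simp_rw [inner] at hsm ⊢
  rw [tsum_sub_succ_eq (f := fun m : ℕ => Real.arctan ((m : ℝ) * τ / y) / 2) hsm
    (l := Real.pi / 2 / 2)]
  · simp
    ring
  · have := (tendsto_arctan_add_div 0 hy hτ).div_const 2
    simpa using this

lemma latticeInv_term_eq {τ : ℝ} {y : ℝ} (hy : 0 < y) (k : ℕ × ℕ) :
    latticeInv τ k ^ 3 * y / (1 + latticeInv τ k ^ 2 * y ^ 2) ^ 2 =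
      ((k.1 : ℝ) * τ + k.2) * y / (((k.1 : ℝ) * τ + k.2) ^ 2 + y ^ 2) ^ 2 := by
  unfold latticeInv
  generalize (k.1 : ℝ) * τ + k.2 = x
  by_cases hx : x = 0
  · simp [hx]
  · have : x ^ 2 + y ^ 2 ≠ 0 := by positivity
    have h2 : 1 + x⁻¹ ^ 2 * y ^ 2 = (x ^ 2 + y ^ 2) / x ^ 2 := by field_simp
    rw [h2]
    field_simp

lemma tendsto_tsum_latticeInv {τ : ℝ} (hτ : 0 < τ) :
    Tendsto (fun y : ℝ => ∑' k, latticeInv τ k ^ 3 * y / (1 + latticeInv τ k ^ 2 * y ^ 2) ^ 2)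
      atTop (nhds (Real.pi / (4 * τ))) := by
  set g : ℝ → ℕ × ℕ → ℝ := fun y k =>
    latticeInv τ k ^ 3 * y / (1 + latticeInv τ k ^ 2 * y ^ 2) ^ 2 with hg
  set C : ℝ := τ * (1 + τ) * 3 with hC
  have hC0 : 0 ≤ C := by positivity
  set bound : ℕ × ℕ → ℝ := fun k => C * (latticeInv τ k ^ 3 + if k = (0, 0) then 1 else 0)
    with hbound
  have hv3 := summable_latticeInv_pow hτ
  have hbs : Summable bound :=
    (hv3.add (hasSum_ite_eq ((0, 0) : ℕ × ℕ) (1 : ℝ)).summable).mul_left C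
  have hω : ∀ k : ℕ × ℕ, 0 ≤ (k.1 : ℝ) * τ + k.2 := fun k => by positivity
  have hbase : ∀ y : ℝ, 0 < y → ∀ k, |arctanDiff τ y k - τ * g y k| ≤
      C * (y / (((k.1 : ℝ) * τ + k.2) ^ 2 + y ^ 2) ^ 2) := by
    intro y hy k
    rw [hg]
    simp only
    rw [latticeInv_term_eq hy]
    refine (abs_arctan_second_difference_le hτ.le (hω k) hy).trans (le_of_eq ?_)
    rw [hC]
    ring
  have hle : ∀ y : ℝ, 1 ≤ y → ∀ k, ‖arctanDiff τ y k - τ * g y k‖ ≤ bound k := by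
    intro y hy k
    have hy0 : 0 < y := by linarith
    refine (hbase y hy0 k).trans (mul_le_mul_of_nonneg_left ?_ hC0)
    have hx := hω k
    by_cases hk : k = (0, 0)
    · rw [if_pos hk, hk, latticeInv_zero]
      simp only [CharP.cast_eq_zero]
      rw [div_le_iff₀ (by positivity)]
      have : y ^ 1 ≤ y ^ 4 := pow_le_pow_right₀ hy (by norm_num)
      nlinarith
    · rw [if_neg hk, add_zero]
      unfold latticeInv
      have hpos : 0 < (k.1 : ℝ) * τ + k.2 := by
        rcases hx.lt_or_eq with h | h
        · exact h
        · exfalso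
          apply hk
          have h1 : (0 : ℝ) ≤ k.1 * τ := by positivity
          have h2 : (0 : ℝ) ≤ k.2 := by positivity
          have h3 : (k.1 : ℝ) * τ = 0 := by linarith
          have h4 : (k.2 : ℝ) = 0 := by linarith
          ext
          · simpa [hτ.ne'] using h3
          · simpa using h4
      generalize (k.1 : ℝ) * τ + k.2 = x at hpos
      rw [inv_pow, div_le_iff₀ (by positivity), inv_mul_eq_div, le_div_iff₀ (by positivity)]
      have e1 : y * x ≤ x ^ 2 + y ^ 2 := by nlinarith [sq_nonneg (x - y), sq_nonneg (x + y)]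
      have e2 : x ^ 2 ≤ x ^ 2 + y ^ 2 := by nlinarith [sq_nonneg y]
      calc y * x ^ 3 = (y * x) * x ^ 2 := by ring
        _ ≤ (x ^ 2 + y ^ 2) * (x ^ 2 + y ^ 2) := by gcongr
        _ = _ := by ring
  have hgs : ∀ y : ℝ, 1 ≤ y → Summable (g y) := by
    intro y hy
    have hy0 : 0 < y := by linarith
    refine Summable.of_nonneg_of_le (fun k => ?_) (fun k => ?_) (hv3.mul_right y)
    · have := latticeInv_nonneg hτ k
      positivity
    · have := latticeInv_nonneg hτ k
      refine div_le_self (by positivity) (one_le_pow₀ ?_)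
      have : 0 ≤ latticeInv τ k ^ 2 * y ^ 2 := by positivity
      linarith
  have hterm : ∀ k, Tendsto (fun y => arctanDiff τ y k - τ * g y k) atTop (nhds 0) := by
    intro k
    have hlim : Tendsto (fun y : ℝ => C * (y ^ 3)⁻¹) atTop (nhds 0) := by
      simpa using (tendsto_inv_atTop_zero.comp
        (tendsto_pow_atTop (α := ℝ) three_ne_zero)).const_mul C
    refine squeeze_zero_norm' ?_ hlim
    filter_upwards [eventually_gt_atTop 0] with y hy
    refine (hbase y hy k).trans (mul_le_mul_of_nonneg_left ?_ hC0)
    rw [div_le_iff₀ (by positivity), inv_mul_eq_div, le_div_iff₀ (by positivity)]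
    have e2 : y ^ 2 ≤ ((k.1 : ℝ) * τ + k.2) ^ 2 + y ^ 2 := by nlinarith [hω k]
    calc y * y ^ 3 = (y ^ 2) ^ 2 := by ring
      _ ≤ _ := by gcongr
  have hmain := tendsto_tsum_of_dominated_convergence hbs hterm
    (by filter_upwards [eventually_ge_atTop 1] with y hy using hle y hy)
  rw [tsum_zero] at hmain
  have hfin : Tendsto (fun y => (Real.pi / 4 - ∑' k, (arctanDiff τ y k - τ * g y k)) / τ) atTop
      (nhds (Real.pi / (4 * τ))) := by
    have := (hmain.const_sub (Real.pi / 4)).div_const τ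
    rw [sub_zero, div_div] at this
    exact this
  refine hfin.congr' ?_
  filter_upwards [eventually_ge_atTop 1] with y hy
  have hd : Summable fun k => arctanDiff τ y k - τ * g y k :=
    Summable.of_norm_bounded hbs (hle y hy)
  have hτg := (hgs y hy).mul_left τ
  have hA : Summable (arctanDiff τ y) := by
    simpa using hd.add hτg
  rw [hA.tsum_sub hτg, tsum_arctanDiff hτ (by linarith) hA, tsum_mul_left]
  field_simp
  ring

/-- The series part of the derivative of the logarithmic derivative of the Barnes double gamma
function at `iy`. -/
def latticeQ (τ y : ℝ) : ℂ :=
  ∑' k, (latticeInv τ k : ℂ) ^ 2 * (1 - 1 / (1 + latticeInv τ k * (y * Complex.I)) ^ 2)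

lemma one_le_norm_one_add_mul_I (v y : ℝ) : 1 ≤ ‖1 + (v : ℂ) * (y * Complex.I)‖ := by
  have := Complex.abs_re_le_norm (1 + (v : ℂ) * (y * Complex.I))
  simpa using this

lemma abs_mul_le_norm_one_add_mul_I (v y : ℝ) : |v * y| ≤ ‖1 + (v : ℂ) * (y * Complex.I)‖ := by
  have := Complex.abs_im_le_norm (1 + (v : ℂ) * (y * Complex.I))
  simpa using this

lemma one_add_mul_I_ne_zero (v y : ℝ) : 1 + (v : ℂ) * (y * Complex.I) ≠ 0 :=
  norm_pos_iff.1 (one_pos.trans_le (one_le_norm_one_add_mul_I v y))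

lemma summable_latticeQ {τ : ℝ} (hτ : 0 < τ) (y : ℝ) : Summable fun k =>
    (latticeInv τ k : ℂ) ^ 2 * (1 - 1 / (1 + latticeInv τ k * (y * Complex.I)) ^ 2) := by
  refine Summable.of_norm_bounded ((summable_latticeInv_pow hτ).mul_right (2 * |y|)) fun k => ?_
  have hv := latticeInv_nonneg hτ k
  generalize latticeInv τ k = v at hv
  have h1 := one_le_norm_one_add_mul_I v y
  have h0 := one_add_mul_I_ne_zero v y
  have e : (v : ℂ) ^ 2 * (1 - 1 / (1 + v * (y * Complex.I)) ^ 2) =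
      (v : ℂ) ^ 3 * (y * Complex.I) * (1 + (1 + v * (y * Complex.I))) /
        (1 + v * (y * Complex.I)) ^ 2 := by
    generalize (y : ℂ) * Complex.I = x at h0 ⊢
    field_simp
    ring
  have h2 : ‖1 + (1 + (v : ℂ) * (y * Complex.I))‖ ≤ 1 + ‖1 + (v : ℂ) * (y * Complex.I)‖ := by
    simpa using norm_add_le (1 : ℂ) (1 + (v : ℂ) * (y * Complex.I))
  rw [e, norm_div, norm_mul, norm_mul, norm_mul, norm_pow, norm_pow, Complex.norm_real,
    Complex.norm_real, Complex.norm_I, mul_one, Real.norm_of_nonneg hv, Real.norm_eq_abs,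
    div_le_iff₀ (by positivity)]
  have h3 : ‖1 + (1 + (v : ℂ) * (y * Complex.I))‖ ≤ 2 * ‖1 + (v : ℂ) * (y * Complex.I)‖ ^ 2 := by
    nlinarith
  calc _ ≤ v ^ 3 * |y| * (2 * ‖1 + (v : ℂ) * (y * Complex.I)‖ ^ 2) := by gcongr
    _ = _ := by ring

lemma latticeQ_neg_sub {τ : ℝ} (hτ : 0 < τ) (y : ℝ) : latticeQ τ (-y) - latticeQ τ y =
    -4 * Complex.I * ((∑' k, latticeInv τ k ^ 3 * y / (1 + latticeInv τ k ^ 2 * y ^ 2) ^ 2 : ℝ) : ℂ)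
    := by
  unfold latticeQ
  rw [← (summable_latticeQ hτ (-y)).tsum_sub (summable_latticeQ hτ y), Complex.ofReal_tsum,
    ← tsum_mul_left]
  refine tsum_congr fun k => ?_
  generalize latticeInv τ k = v
  have h1 := one_add_mul_I_ne_zero v y
  have h2 := one_add_mul_I_ne_zero v (-y)
  have e : (1 : ℂ) + v ^ 2 * y ^ 2 =
      (1 + v * (y * Complex.I)) * (1 + v * (-(y * Complex.I))) := by
    ring_nf
    rw [Complex.I_sq]
    ring
  have e' : -4 * Complex.I * ((v : ℂ) ^ 3 * y / (1 + v ^ 2 * y ^ 2) ^ 2) =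
      -4 * (v : ℂ) ^ 3 * (y * Complex.I) / (1 + v ^ 2 * y ^ 2) ^ 2 := by ring
  push_cast at h2 ⊢
  rw [e', e]
  rw [neg_mul] at h2 ⊢
  generalize (y : ℂ) * Complex.I = x at h1 h2 ⊢
  rw [mul_neg, ← sub_eq_add_neg] at h2 ⊢
  field_simp
  ring

lemma tendsto_latticeQ_neg_sub {τ : ℝ} (hτ : 0 < τ) :
    Tendsto (fun y => latticeQ τ (-y) - latticeQ τ y) atTop
      (nhds (-(Complex.I * Real.pi / τ))) := by
  have h := ((Complex.continuous_ofReal.tendsto _).comp (tendsto_tsum_latticeInv hτ)).const_mul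
    (-4 * Complex.I)
  have hτ' : (τ : ℂ) ≠ 0 := by exact_mod_cast hτ.ne'
  have e : -(Complex.I * Real.pi / τ) = -4 * Complex.I * ((Real.pi / (4 * τ) : ℝ) : ℂ) := by
    push_cast
    field_simp
  rw [e]
  exact h.congr fun y => (latticeQ_neg_sub hτ y).symm

lemma tendsto_abs_cocompact_real : Tendsto (fun y : ℝ => |y|) (cocompact ℝ) atTop :=
  tendsto_norm_cocompact_atTop

lemma tendsto_logDeriv_barnesG_sub {τ : ℝ} (hτ : 0 < τ) (β : ℂ) :
    Tendsto (fun y : ℝ => logDeriv (fun z => barnesG z τ) (β + y * Complex.I) -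
      logDeriv (fun z => barnesG z τ) (y * Complex.I) - β * (bBarnes τ / τ + latticeQ τ y))
      (cocompact ℝ) (nhds 0) := by
  have hv3 := summable_latticeInv_pow hτ
  have hlarge : ∀ᶠ y : ℝ in cocompact ℝ, 2 * ‖β‖ + 1 ≤ |y| :=
    tendsto_abs_cocompact_real.eventually_ge_atTop _
  have hsec : ∀ y : ℝ, 2 * ‖β‖ + 1 ≤ |y| →
      |(β + y * Complex.I).re| ≤ |(β + y * Complex.I).im| ∧ (β + y * Complex.I).im ≠ 0 := by
    intro y hy
    have h1 := Complex.abs_re_le_norm β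
    have h2 := Complex.abs_im_le_norm β
    have h3 : |y| ≤ |β.im + y| + |β.im| := by
      have := abs_sub (β.im + y) β.im
      rwa [add_sub_cancel_left] at this
    have h4 : (β + y * Complex.I).re = β.re := by simp
    have h5 : (β + y * Complex.I).im = β.im + y := by simp
    rw [h4, h5]
    refine ⟨by linarith, fun h => ?_⟩
    rw [h, abs_zero] at h3
    have := norm_nonneg β
    linarith
  set T : ℝ → ℕ × ℕ → ℂ := fun y k => β ^ 2 * (latticeInv τ k : ℂ) ^ 3 /
    ((1 + latticeInv τ k * (y * Complex.I)) ^ 2 * (1 + latticeInv τ k * (β + y * Complex.I)))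
    with hT
  have hTnorm : ∀ y : ℝ, 2 * ‖β‖ + 1 ≤ |y| → ∀ k, ‖T y k‖ ≤ 2 * ‖β‖ ^ 2 * latticeInv τ k ^ 3 /
      ‖1 + (latticeInv τ k : ℂ) * (y * Complex.I)‖ ^ 2 := by
    intro y hy k
    have hv := latticeInv_nonneg hτ k
    have h1 := half_le_norm_one_add (v := latticeInv τ k) (hsec y hy).1
    have h2 := one_le_norm_one_add_mul_I (latticeInv τ k) y
    simp only [hT]
    rw [norm_div, norm_mul, norm_mul, norm_pow, norm_pow, norm_pow, Complex.norm_real,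
      Real.norm_of_nonneg hv, div_le_div_iff₀ (by positivity) (by positivity)]
    have : 0 ≤ ‖β‖ ^ 2 * latticeInv τ k ^ 3 * ‖1 + (latticeInv τ k : ℂ) * (y * Complex.I)‖ ^ 2 := by
      positivity
    nlinarith
  have hTlim : Tendsto (fun y => ∑' k, T y k) (cocompact ℝ) (nhds 0) := by
    have := tendsto_tsum_of_dominated_convergence (f := T) (g := fun _ => (0 : ℂ))
      (𝓕 := cocompact ℝ) (hv3.mul_left (2 * ‖β‖ ^ 2)) (fun k => ?_) ?_
    · simpa using this
    · have hl : Tendsto (fun y : ℝ => 2 * ‖β‖ ^ 2 * latticeInv τ k * (|y| ^ 2)⁻¹) (cocompact ℝ)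
          (nhds 0) := by
        simpa using ((tendsto_inv_atTop_zero.comp (tendsto_pow_atTop (α := ℝ) two_ne_zero)).comp
          tendsto_abs_cocompact_real).const_mul (2 * ‖β‖ ^ 2 * latticeInv τ k)
      refine squeeze_zero_norm' ?_ hl
      filter_upwards [hlarge] with y hy
      refine (hTnorm y hy k).trans ?_
      have hv := latticeInv_nonneg hτ k
      have h1 := one_le_norm_one_add_mul_I (latticeInv τ k) y
      have h2 := abs_mul_le_norm_one_add_mul_I (latticeInv τ k) y
      have hy0 : 0 < |y| := by
        have := norm_nonneg β
        linarith
      rw [← div_eq_mul_inv, div_le_div_iff₀ (by positivity) (by positivity)]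
      rw [abs_mul, abs_of_nonneg hv] at h2
      have h3 : (latticeInv τ k * |y|) ^ 2 ≤
          ‖1 + (latticeInv τ k : ℂ) * (y * Complex.I)‖ ^ 2 := by gcongr
      calc 2 * ‖β‖ ^ 2 * latticeInv τ k ^ 3 * |y| ^ 2
          = 2 * ‖β‖ ^ 2 * latticeInv τ k * (latticeInv τ k * |y|) ^ 2 := by ring
        _ ≤ _ := by gcongr
    · filter_upwards [hlarge] with y hy k
      refine (hTnorm y hy k).trans (div_le_self ?_ (one_le_pow₀ (one_le_norm_one_add_mul_I _ _)))
      have := latticeInv_nonneg hτ k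
      positivity
  have hinv : ∀ β : ℂ, Tendsto (fun y : ℝ => 1 / (β + y * Complex.I)) (cocompact ℝ) (nhds 0) := by
    intro β
    have h1 : Tendsto (fun y : ℝ => β + y * Complex.I) (cocompact ℝ)
        (Bornology.cobounded ℂ) := by
      rw [← comap_norm_atTop (E := ℂ), tendsto_comap_iff]
      refine tendsto_atTop_mono (f := fun y : ℝ => |y| - ‖β‖) (fun y => ?_)
        (tendsto_atTop_add_const_right _ _ tendsto_abs_cocompact_real)
      have h2 : ‖(y : ℂ) * Complex.I‖ ≤ ‖β + y * Complex.I‖ + ‖β‖ := by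
        have := norm_sub_le (β + y * Complex.I) β
        rwa [add_sub_cancel_left] at this
      rw [norm_mul, Complex.norm_real, Complex.norm_I, mul_one, Real.norm_eq_abs] at h2
      simp only [Function.comp]
      linarith
    simpa [-cocompact_eq_atBot_atTop, Function.comp_def] using
      (tendsto_inv₀_cobounded (α := ℂ)).comp h1
  have hfin := ((hinv β).sub (hinv 0)).add hTlim
  rw [sub_zero, zero_add] at hfin
  refine hfin.congr' ?_
  filter_upwards [hlarge] with y hy
  obtain ⟨hz, him⟩ := hsec y hy
  have hy0 : y ≠ 0 := by
    rintro rfl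
    have := norm_nonneg β
    rw [abs_zero] at hy
    linarith
  have hz0 : |((y : ℂ) * Complex.I).re| ≤ |((y : ℂ) * Complex.I).im| := by simp
  have him0 : ((y : ℂ) * Complex.I).im ≠ 0 := by simpa using hy0
  have hβ := summable_logDeriv_barnesG hτ hz
  have h0 := summable_logDeriv_barnesG hτ hz0
  have hQ := (summable_latticeQ hτ y).mul_left β
  have key : ∑' k, T y k =
      ∑' k, (latticeInv τ k : ℂ) ^ 3 * (β + y * Complex.I) ^ 2 /
        (1 + latticeInv τ k * (β + y * Complex.I)) -
      ∑' k, (latticeInv τ k : ℂ) ^ 3 * (y * Complex.I) ^ 2 /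
        (1 + latticeInv τ k * (y * Complex.I)) - β * latticeQ τ y := by
    unfold latticeQ
    rw [← tsum_mul_left, ← hβ.tsum_sub h0, ← (hβ.sub h0).tsum_sub hQ]
    refine tsum_congr fun k => ?_
    have h1 := one_add_mul_I_ne_zero (latticeInv τ k) y
    have h2 : 1 + (latticeInv τ k : ℂ) * (β + y * Complex.I) ≠ 0 := by
      have := half_le_norm_one_add (v := latticeInv τ k) hz
      exact norm_pos_iff.1 (by linarith)
    simp only [hT]
    generalize (latticeInv τ k : ℂ) = v at *
    generalize (y : ℂ) * Complex.I = x at *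
    field_simp
    ring
  rw [logDeriv_barnesG hτ hz him, logDeriv_barnesG hτ hz0 him0, key]
  rw [zero_add]
  ring

lemma exists_norm_le_of_tendsto_logDeriv {F Ω : ℝ → ℂ} {L : ℂ} {κ : ℝ}
    (hF : ∀ᶠ y in atTop, HasDerivAt F (Ω y * F y) y) (hΩ : Tendsto Ω atTop (nhds L))
    (hL : L.re < -κ) : ∃ C, ∀ᶠ y in atTop, ‖F y‖ * Real.exp (κ * y) ≤ C := by
  have hre : ∀ᶠ y in atTop, (Ω y).re < -κ :=
    ((Complex.continuous_re.tendsto L).comp hΩ).eventually_lt_const hL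
  obtain ⟨T, hT⟩ := eventually_atTop.1 (hF.and hre)
  have hg : ∀ y ≥ T, HasDerivAt (fun y => ‖F y‖ ^ 2 * Real.exp (κ * y) ^ 2)
      (2 * ((Ω y).re + κ) * (‖F y‖ ^ 2 * Real.exp (κ * y) ^ 2)) y := by
    intro y hy
    have h1 := (hT y hy).1.norm_sq
    have h2 := (((hasDerivAt_id y).const_mul κ).exp).pow 2
    refine (h1.mul h2).congr_deriv ?_
    have h3 : inner ℝ (F y) (Ω y * F y) = (Ω y).re * ‖F y‖ ^ 2 := by
      rw [Complex.inner, ← Complex.normSq_eq_norm_sq, Complex.normSq_apply]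
      simp
      ring
    rw [h3]
    simp
    ring
  have hanti : AntitoneOn (fun y => ‖F y‖ ^ 2 * Real.exp (κ * y) ^ 2) (Ici T) := by
    refine antitoneOn_of_deriv_nonpos (convex_Ici T)
      (fun y hy => (hg y hy).continuousAt.continuousWithinAt) (fun y hy => ?_) fun y hy => ?_
    · exact (hg y (interior_subset hy)).differentiableAt.differentiableWithinAt
    · rw [(hg y (interior_subset hy)).deriv]
      have := (hT y (interior_subset hy)).2
      exact mul_nonpos_of_nonpos_of_nonneg (by linarith) (by positivity)
  refine ⟨‖F T‖ * Real.exp (κ * T), ?_⟩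
  filter_upwards [eventually_ge_atTop T] with y hy
  have := hanti (self_mem_Ici) hy hy
  simp only [← mul_pow] at this
  exact (pow_le_pow_iff_left₀ (by positivity) (by positivity) two_ne_zero).1 this

lemma logDeriv_prod_ite {ι : Type*} [Fintype ι] (P : ι → Prop) [DecidablePred P]
    (f : ι → ℂ → ℂ) (x : ℂ) (hf : ∀ i, P i → f i x ≠ 0)
    (hd : ∀ i, P i → DifferentiableAt ℂ (f i) x) :
    logDeriv (fun z => ∏ i, if P i then f i z else 1) x =
      ∑ i, (if P i then 1 else 0) * logDeriv (f i) x := by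
  have e : ∀ i, (fun z => if P i then f i z else 1) = if P i then f i else fun _ => 1 := by
    intro i
    split_ifs <;> rfl
  have h := logDeriv_prod (s := Finset.univ) (f := fun i z => if P i then f i z else 1) (x := x)
    (fun i _ => ?_) (fun i _ => ?_)
  · rw [h]
    refine Finset.sum_congr rfl fun i _ => ?_
    rw [e]
    split_ifs <;> simp
  · split_ifs with hi
    · exact hf i hi
    · exact one_ne_zero
  · rw [e]
    split_ifs with hi
    · exact hd i hi
    · exact differentiableAt_const _

lemma logDeriv_barnesG_const_add {τ : ℝ} (hτ : 0 < τ) (β s : ℂ) :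
    logDeriv (fun s => barnesG (β + s) τ) s = logDeriv (fun z => barnesG z τ) (β + s) := by
  have := logDeriv_comp (f := fun z => barnesG z τ) (g := fun s => β + s) (x := s)
    (differentiable_barnesG hτ _) (by fun_prop)
  simpa [Function.comp_def] using this

lemma logDeriv_barnesG_const_sub {τ : ℝ} (hτ : 0 < τ) (β s : ℂ) :
    logDeriv (fun s => barnesG (β - s) τ) s = -logDeriv (fun z => barnesG z τ) (β - s) := by
  have := logDeriv_comp (f := fun z => barnesG z τ) (g := fun s => β - s) (x := s)
    (differentiable_barnesG hτ _) (by fun_prop)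
  simpa [Function.comp_def] using this

lemma eventually_add_mul_I_mem_slitPlane (β : ℂ) :
    ∀ᶠ y : ℝ in cocompact ℝ, β + y * Complex.I ∈ slitPlane ∧ β - y * Complex.I ∈ slitPlane := by
  filter_upwards [tendsto_abs_cocompact_real.eventually_gt_atTop |β.im|] with y hy
  refine ⟨Complex.mem_slitPlane_iff.2 (Or.inr fun h => ?_),
    Complex.mem_slitPlane_iff.2 (Or.inr fun h => ?_)⟩
  · have : y = -β.im := by
      simp at h
      linarith
    simp [this] at hy
  · have : y = β.im := by
      simp at h
      linarith
    simp [this] at hy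

lemma tendsto_sum_logDeriv_barnesG_sub {τ : ℝ} (hτ : 0 < τ) {ι : Type*} [Fintype ι]
    (u β : ι → ℂ) :
    Tendsto (fun y : ℝ => ∑ j, u j * logDeriv (fun z => barnesG z τ) (β j + y * Complex.I) -
      (∑ j, u j) * logDeriv (fun z => barnesG z τ) (y * Complex.I) -
      (∑ j, u j * β j) * (bBarnes τ / τ + latticeQ τ y)) (cocompact ℝ) (nhds 0) := by
  have h := tendsto_finsetSum (Finset.univ : Finset ι) fun j _ =>
    (tendsto_logDeriv_barnesG_sub hτ (β j)).const_mul (u j)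
  simp only [mul_zero, Finset.sum_const_zero] at h
  refine h.congr fun y => ?_
  rw [Finset.sum_mul, Finset.sum_mul, ← Finset.sum_sub_distrib, ← Finset.sum_sub_distrib]
  exact Finset.sum_congr rfl fun j _ => by ring

lemma sum_ite_val_lt {m p : ℕ} (hm : m ≤ p) :
    ∑ j : Fin p, (if (j : ℕ) < m then 1 else 0 : ℂ) = m := by
  rw [Fin.sum_univ_eq_sum_range (fun i => (if i < m then 1 else 0 : ℂ)), ← Finset.sum_filter]
  have : (Finset.range p).filter (· < m) = Finset.range m := by
    ext i
    simp only [Finset.mem_filter, Finset.mem_range]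
    omega
  simp [this]

lemma eventually_logDeriv_calG {τ : ℝ} (hτ : 0 < τ) (m n : ℕ) {p : ℕ} (a b : Fin p → ℂ) (c : ℂ) :
    ∀ᶠ y : ℝ in cocompact ℝ,
      calG m n a b (c + y * Complex.I) τ ≠ 0 ∧
      DifferentiableAt ℂ (fun s => calG m n a b s τ) (c + y * Complex.I) ∧
      logDeriv (fun s => calG m n a b s τ) (c + y * Complex.I) =
        -∑ j : Fin p, (if (j : ℕ) < m then 1 else 0) *
            logDeriv (fun z => barnesG z τ) ((b j - c) + (-y : ℝ) * Complex.I) +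
          ∑ j : Fin p, (if (j : ℕ) < n then 1 else 0) *
            logDeriv (fun z => barnesG z τ) ((1 + τ - a j + c) + y * Complex.I) -
          (∑ j : Fin p, (if m ≤ (j : ℕ) then 1 else 0) *
            logDeriv (fun z => barnesG z τ) ((1 + τ - b j + c) + y * Complex.I) -
          ∑ j : Fin p, (if n ≤ (j : ℕ) then 1 else 0) *
            logDeriv (fun z => barnesG z τ) ((a j - c) + (-y : ℝ) * Complex.I)) := by
  have hb : ∀ᶠ y : ℝ in cocompact ℝ, ∀ j, b j - (c + y * Complex.I) ∈ slitPlane ∧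
      a j - (c + y * Complex.I) ∈ slitPlane ∧
      1 + τ - a j + (c + y * Complex.I) ∈ slitPlane ∧
      1 + τ - b j + (c + y * Complex.I) ∈ slitPlane := by
    refine eventually_all.2 fun j => ?_
    filter_upwards [eventually_add_mul_I_mem_slitPlane (b j - c),
      eventually_add_mul_I_mem_slitPlane (a j - c),
      eventually_add_mul_I_mem_slitPlane (1 + τ - a j + c),
      eventually_add_mul_I_mem_slitPlane (1 + τ - b j + c)] with y h1 h2 h3 h4
    simp only [← sub_sub, ← add_assoc]
    exact ⟨h1.2, h2.2, h3.1, h4.1⟩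
  have hG := differentiable_barnesG hτ
  have hGa : ∀ β, Differentiable ℂ fun s => barnesG (β + s) τ := fun β => hG.comp (by fun_prop)
  have hGs : ∀ β, Differentiable ℂ fun s => barnesG (β - s) τ := fun β => hG.comp (by fun_prop)
  filter_upwards [hb] with y hy
  have hN0 : ∀ (f : Fin p → ℂ → ℂ) (P : Fin p → Prop) [DecidablePred P],
      (∀ j, f j (c + y * Complex.I) ≠ 0) →
      (∏ j, if P j then f j (c + y * Complex.I) else 1) ≠ 0 := by
    intro f P _ hf
    refine Finset.prod_ne_zero_iff.2 fun j _ => ?_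
    split_ifs
    · exact hf j
    · exact one_ne_zero
  have hD : ∀ (f : Fin p → ℂ → ℂ) (P : Fin p → Prop) [DecidablePred P],
      (∀ j, Differentiable ℂ (f j)) →
      Differentiable ℂ (fun s => ∏ j, if P j then f j s else 1) := by
    intro f P _ hf
    refine Differentiable.fun_finsetProd fun j _ => ?_
    split_ifs
    · exact hf j
    · exact differentiable_const _
  have n1 : ∀ j, barnesG (b j - (c + y * Complex.I)) τ ≠ 0 :=
    fun j => barnesG_ne_zero hτ (hy j).1
  have n2 : ∀ j, barnesG (1 + τ - a j + (c + y * Complex.I)) τ ≠ 0 :=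
    fun j => barnesG_ne_zero hτ (hy j).2.2.1
  have n3 : ∀ j, barnesG (1 + τ - b j + (c + y * Complex.I)) τ ≠ 0 :=
    fun j => barnesG_ne_zero hτ (hy j).2.2.2
  have n4 : ∀ j, barnesG (a j - (c + y * Complex.I)) τ ≠ 0 :=
    fun j => barnesG_ne_zero hτ (hy j).2.1
  have p1 := hN0 (fun j s => barnesG (b j - s) τ) (fun j => (j : ℕ) < m) n1
  have p2 := hN0 (fun j s => barnesG (1 + τ - a j + s) τ) (fun j => (j : ℕ) < n) n2
  have p3 := hN0 (fun j s => barnesG (1 + τ - b j + s) τ) (fun j => m ≤ (j : ℕ)) n3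
  have p4 := hN0 (fun j s => barnesG (a j - s) τ) (fun j => n ≤ (j : ℕ)) n4
  have d1 := hD (fun j s => barnesG (b j - s) τ) (fun j => (j : ℕ) < m) fun j => hGs _
  have d2 := hD (fun j s => barnesG (1 + τ - a j + s) τ) (fun j => (j : ℕ) < n) fun j => hGa _
  have d3 := hD (fun j s => barnesG (1 + τ - b j + s) τ) (fun j => m ≤ (j : ℕ)) fun j => hGa _
  have d4 := hD (fun j s => barnesG (a j - s) τ) (fun j => n ≤ (j : ℕ)) fun j => hGs _
  refine ⟨div_ne_zero (mul_ne_zero p1 p2) (mul_ne_zero p3 p4),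
    ((d1 _).mul (d2 _)).div ((d3 _).mul (d4 _)) (mul_ne_zero p3 p4), ?_⟩
  unfold calG
  rw [logDeriv_div (f := fun s => (∏ j : Fin p, if (j : ℕ) < m then barnesG (b j - s) τ else 1) *
      ∏ j : Fin p, if (j : ℕ) < n then barnesG (1 + τ - a j + s) τ else 1)
    (g := fun s => (∏ j : Fin p, if m ≤ (j : ℕ) then barnesG (1 + τ - b j + s) τ else 1) *
      ∏ j : Fin p, if n ≤ (j : ℕ) then barnesG (a j - s) τ else 1) _ (mul_ne_zero p1 p2)
      (mul_ne_zero p3 p4) ((d1 _).mul (d2 _)) ((d3 _).mul (d4 _)),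
    logDeriv_mul (f := fun s => ∏ j : Fin p, if (j : ℕ) < m then barnesG (b j - s) τ else 1)
      (g := fun s => ∏ j : Fin p, if (j : ℕ) < n then barnesG (1 + τ - a j + s) τ else 1) _
      p1 p2 (d1 _) (d2 _),
    logDeriv_mul (f := fun s => ∏ j : Fin p, if m ≤ (j : ℕ) then barnesG (1 + τ - b j + s) τ else 1)
      (g := fun s => ∏ j : Fin p, if n ≤ (j : ℕ) then barnesG (a j - s) τ else 1) _
      p3 p4 (d3 _) (d4 _),
    logDeriv_prod_ite (fun j : Fin p => (j : ℕ) < m) (fun j s => barnesG (b j - s) τ) _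
      (fun j _ => n1 j) (fun j _ => hGs _ _),
    logDeriv_prod_ite (fun j : Fin p => (j : ℕ) < n) (fun j s => barnesG (1 + τ - a j + s) τ) _
      (fun j _ => n2 j) (fun j _ => hGa _ _),
    logDeriv_prod_ite (fun j : Fin p => m ≤ (j : ℕ)) (fun j s => barnesG (1 + τ - b j + s) τ) _
      (fun j _ => n3 j) (fun j _ => hGa _ _),
    logDeriv_prod_ite (fun j : Fin p => n ≤ (j : ℕ)) (fun j s => barnesG (a j - s) τ) _
      (fun j _ => n4 j) (fun j _ => hGs _ _)]
  simp only [logDeriv_barnesG_const_add hτ, logDeriv_barnesG_const_sub hτ, mul_neg,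
    Finset.sum_neg_distrib, Complex.ofReal_neg, neg_mul, ← sub_eq_add_neg, sub_sub, add_assoc]

lemma tendsto_logDeriv_calG_sub {τ : ℝ} (hτ : 0 < τ) {m n p : ℕ} (hm : m ≤ p) (hn : n ≤ p)
    {a b : Fin p → ℂ} (hN : paramN m n p p = 0) (hμ : paramMu m n a b = 0) (c : ℂ) :
    Tendsto (fun y : ℝ => logDeriv (fun s => calG m n a b s τ) (c + y * Complex.I) -
      paramNu a b / 2 * (latticeQ τ (-y) - latticeQ τ y)) (cocompact ℝ) (nhds 0) := by
  have hneg : Tendsto (fun y : ℝ => -y) (cocompact ℝ) (cocompact ℝ) :=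
    (Homeomorph.neg ℝ).isClosedEmbedding.tendsto_cocompact
  have h1 := (tendsto_sum_logDeriv_barnesG_sub hτ
    (fun j : Fin p => if (j : ℕ) < m then 1 else 0) fun j => b j - c).comp hneg
  have h2 := tendsto_sum_logDeriv_barnesG_sub hτ
    (fun j : Fin p => if (j : ℕ) < n then 1 else 0) fun j => 1 + τ - a j + c
  have h3 := tendsto_sum_logDeriv_barnesG_sub hτ
    (fun j : Fin p => if m ≤ (j : ℕ) then 1 else 0) fun j => 1 + τ - b j + c
  have h4 := (tendsto_sum_logDeriv_barnesG_sub hτ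
    (fun j : Fin p => if n ≤ (j : ℕ) then 1 else 0) fun j => a j - c).comp hneg
  have h := ((h1.neg.add h2).sub (h3.sub h4))
  simp only [neg_zero, add_zero, sub_zero] at h
  refine h.congr' ?_
  have hmn : (m : ℂ) + n = p := by
    have : m + n = p := by
      unfold paramN at hN
      omega
    exact_mod_cast this
  have hcompl : ∀ (k : ℕ) (f : Fin p → ℂ), ∑ j : Fin p, (if k ≤ (j : ℕ) then 1 else 0) * f j =
      ∑ j, f j - ∑ j : Fin p, (if (j : ℕ) < k then 1 else 0) * f j := by
    intro k f
    rw [← Finset.sum_sub_distrib]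
    refine Finset.sum_congr rfl fun j _ => ?_
    by_cases hj : k ≤ (j : ℕ)
    · simp [hj, not_lt.2 hj]
    · simp [hj, not_le.1 hj]
  have hu := sum_ite_val_lt hm
  have hv := sum_ite_val_lt hn
  have hu' : ∑ j : Fin p, (if m ≤ (j : ℕ) then 1 else 0 : ℂ) = n := by
    have := hcompl m fun _ => 1
    simp only [mul_one, hu] at this
    rw [this]
    simp [← hmn]
  have hv' : ∑ j : Fin p, (if n ≤ (j : ℕ) then 1 else 0 : ℂ) = m := by
    have := hcompl n fun _ => 1
    simp only [mul_one, hv] at this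
    rw [this]
    simp [← hmn]
  have hμ' : (∑ j : Fin p, (if (j : ℕ) < n then 1 else 0) * a j) -
      (∑ j, a j - ∑ j : Fin p, (if (j : ℕ) < n then 1 else 0) * a j) +
      (∑ j : Fin p, (if (j : ℕ) < m then 1 else 0) * b j) -
      (∑ j, b j - ∑ j : Fin p, (if (j : ℕ) < m then 1 else 0) * b j) = 0 := by
    rw [← hcompl, ← hcompl]
    simpa [paramMu] using hμ
  have hsub : ∀ (k : Fin p → ℂ) (f : Fin p → ℂ) (d : ℂ), ∑ j, k j * (f j - d) =
      ∑ j, k j * f j - (∑ j, k j) * d := by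
    intro k f d
    rw [Finset.sum_mul, ← Finset.sum_sub_distrib]
    exact Finset.sum_congr rfl fun j _ => by ring
  have hadd : ∀ (k : Fin p → ℂ) (f : Fin p → ℂ) (d : ℂ), ∑ j, k j * (1 + τ - f j + d) =
      (∑ j, k j) * (1 + τ + d) - ∑ j, k j * f j := by
    intro k f d
    rw [Finset.sum_mul, ← Finset.sum_sub_distrib]
    exact Finset.sum_congr rfl fun j _ => by ring
  filter_upwards [eventually_logDeriv_calG hτ m n a b c] with y hy
  rw [hy.2.2]
  simp only [Function.comp, hu, hv, hu', hv', hsub, hadd, hcompl m b, hcompl n a, paramNu]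
  generalize (∑ j : Fin p, (if (j : ℕ) < n then 1 else 0) * a j) = A at *
  generalize (∑ j : Fin p, (if (j : ℕ) < m then 1 else 0) * b j) = B at *
  linear_combination (latticeQ τ (-y) + latticeQ τ y + 2 * bBarnes τ / τ) / 2 * hμ'

lemma continuous_calG_line {τ : ℝ} (hτ : 0 < τ) (m n : ℕ) {p : ℕ} (a b : Fin p → ℂ) (c : ℝ)
    (hc1 : ∀ j : Fin p, m ≤ (j : ℕ) → (b j).re - τ - 1 < c)
    (hc2 : ∀ k : Fin p, n ≤ (k : ℕ) → c < (a k).re) :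
    Continuous fun t : ℝ => calG m n a b (c + t * Complex.I) τ := by
  have hG := (differentiable_barnesG hτ).continuous
  have hprod : ∀ (f : Fin p → ℝ → ℂ) (P : Fin p → Prop) [DecidablePred P],
      (∀ j, Continuous (f j)) →
      Continuous fun t => ∏ j, if P j then f j t else 1 := by
    intro f P _ hf
    refine continuous_finsetProd _ fun j _ => ?_
    split_ifs
    · exact hf j
    · exact continuous_const
  have hGs : ∀ β : ℂ, Continuous fun t : ℝ => barnesG (β - (c + t * Complex.I)) τ :=
    fun β => hG.comp (by fun_prop)
  have hGa : ∀ β : ℂ, Continuous fun t : ℝ => barnesG (β + (c + t * Complex.I)) τ :=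
    fun β => hG.comp (by fun_prop)
  refine ((hprod _ _ fun j => hGs (b j)).mul (hprod _ _ fun j => hGa (1 + τ - a j))).div
    ((hprod _ _ fun j => hGa (1 + τ - b j)).mul (hprod _ _ fun j => hGs (a j))) fun t =>
    mul_ne_zero (Finset.prod_ne_zero_iff.2 fun j _ => ?_) (Finset.prod_ne_zero_iff.2 fun j _ => ?_)
  · split_ifs with h
    · refine barnesG_ne_zero hτ (Complex.mem_slitPlane_iff.2 (Or.inl ?_))
      have := hc1 j h
      simp
      linarith
    · exact one_ne_zero
  · split_ifs with h
    · refine barnesG_ne_zero hτ (Complex.mem_slitPlane_iff.2 (Or.inl ?_))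
      have := hc2 j h
      simp
      linarith
    · exact one_ne_zero

lemma exists_norm_calG_le {τ : ℝ} (hτ : 0 < τ) {m n p : ℕ} (hm : m ≤ p) (hn : n ≤ p)
    {a b : Fin p → ℂ} (hN : paramN m n p p = 0) (hμ : paramMu m n a b = 0) {c : ℝ}
    (hc1 : ∀ j : Fin p, m ≤ (j : ℕ) → (b j).re - τ - 1 < c)
    (hc2 : ∀ k : Fin p, n ≤ (k : ℕ) → c < (a k).re) {κ : ℝ}
    (hκ : κ < 2 * Real.pi * (-(paramNu a b).re / (4 * τ))) :
    ∃ C, ∀ t : ℝ, ‖calG m n a b (c + t * Complex.I) τ‖ ≤ C * Real.exp (-(κ * |t|)) := by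
  set E : ℝ → ℂ := fun y => logDeriv (fun s => calG m n a b s τ) (c + y * Complex.I) with hE
  have hlim := tendsto_logDeriv_calG_sub hτ hm hn hN hμ c
  have hev := eventually_logDeriv_calG hτ m n a b c
  rw [cocompact_eq_atBot_atTop] at hlim hev
  have hlim1 := hlim.mono_left le_sup_right
  have hlim2 := (hlim.mono_left le_sup_left).comp tendsto_neg_atTop_atBot
  have hQ := (tendsto_latticeQ_neg_sub hτ).const_mul (paramNu a b / 2)
  have hL : (Real.pi * paramNu a b / (2 * τ)).re < -κ := by
    have e : (Real.pi * paramNu a b / (2 * τ) : ℂ) =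
        ((Real.pi / (2 * τ) : ℝ) : ℂ) * paramNu a b := by
      push_cast
      ring
    rw [e, Complex.re_ofReal_mul]
    have e2 : 2 * Real.pi * (-(paramNu a b).re / (4 * τ)) =
      -(Real.pi / (2 * τ) * (paramNu a b).re) := by
      field_simp
      ring
    linarith
  have hder : ∀ y : ℝ, calG m n a b (c + y * Complex.I) τ ≠ 0 →
      DifferentiableAt ℂ (fun s => calG m n a b s τ) (c + y * Complex.I) →
      HasDerivAt (fun y : ℝ => calG m n a b (c + y * Complex.I) τ)
        (Complex.I * E y * calG m n a b (c + y * Complex.I) τ) y := by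
    intro y h0 hd
    have h1 : HasDerivAt (fun y : ℝ => (c : ℂ) + y * Complex.I) Complex.I y := by
      simpa using ((Complex.ofRealCLM.hasDerivAt (x := y)).mul_const Complex.I).const_add (c : ℂ)
    refine (hd.hasDerivAt.comp y h1).congr_deriv ?_
    simp only [hE, logDeriv_apply]
    field_simp
  obtain ⟨C₁, h₁⟩ := exists_norm_le_of_tendsto_logDeriv
    (F := fun y : ℝ => calG m n a b (c + y * Complex.I) τ) (Ω := fun y => Complex.I * E y)
    ((hev.filter_mono le_sup_right).mono fun y hy => hder y hy.1 hy.2.1) (by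
      have h := (hlim1.add hQ).const_mul Complex.I
      have e : Complex.I * (0 + paramNu a b / 2 * -(Complex.I * Real.pi / τ)) =
          Real.pi * paramNu a b / (2 * τ) := by
        linear_combination (-(Real.pi * paramNu a b / (2 * τ)) : ℂ) * Complex.I_sq
      rw [e] at h
      exact h.congr fun y => by simp only [hE]; ring) hL
  obtain ⟨C₂, h₂⟩ := exists_norm_le_of_tendsto_logDeriv
    (F := fun y : ℝ => calG m n a b (c + (-y : ℝ) * Complex.I) τ)
    (Ω := fun y => -(Complex.I * E (-y)))
    ((tendsto_neg_atTop_atBot.eventually (hev.filter_mono le_sup_left)).mono fun y hy => by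
      refine ((hder (-y) hy.1 hy.2.1).scomp y (hasDerivAt_neg y)).congr_deriv ?_
      simp) (by
      have h := (hlim2.sub hQ).const_mul (-Complex.I)
      have e : -Complex.I * (0 - paramNu a b / 2 * -(Complex.I * Real.pi / τ)) =
          Real.pi * paramNu a b / (2 * τ) := by
        linear_combination (-(Real.pi * paramNu a b / (2 * τ)) : ℂ) * Complex.I_sq
      rw [e] at h
      exact h.congr fun y => by simp only [hE, Function.comp, neg_neg]; ring) hL
  have hcont : Continuous fun t : ℝ =>
      ‖calG m n a b (c + t * Complex.I) τ‖ * Real.exp (κ * |t|) :=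
    (continuous_calG_line hτ m n a b c hc1 hc2).norm.mul (by fun_prop)
  have hbd : ∀ᶠ t : ℝ in cocompact ℝ,
      ‖calG m n a b (c + t * Complex.I) τ‖ * Real.exp (κ * |t|) ≤ max C₁ C₂ := by
    rw [cocompact_eq_atBot_atTop, eventually_sup]
    constructor
    · filter_upwards [tendsto_neg_atBot_atTop.eventually h₂, eventually_le_atBot 0] with t ht ht0
      rw [abs_of_nonpos ht0]
      rw [neg_neg] at ht
      exact ht.trans (le_max_right _ _)
    · filter_upwards [h₁, eventually_ge_atTop 0] with t ht ht0
      rw [abs_of_nonneg ht0]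
      exact ht.trans (le_max_left _ _)
  obtain ⟨K, hK, hKb⟩ := mem_cocompact.1 hbd
  obtain ⟨M, hM⟩ := hK.bddAbove_image hcont.continuousOn
  refine ⟨max M (max C₁ C₂), fun t => ?_⟩
  rw [Real.exp_neg, ← div_eq_mul_inv, le_div_iff₀ (Real.exp_pos _)]
  by_cases ht : t ∈ K
  · exact (hM (mem_image_of_mem _ ht)).trans (le_max_left _ _)
  · exact (hKb ht).trans (le_max_right _ _)

lemma integrable_exp_neg_mul_abs {ε : ℝ} (hε : 0 < ε) :
    Integrable fun t : ℝ => Real.exp (-(ε * |t|)) := by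
  rw [← integrableOn_univ, ← Iic_union_Ioi (a := (0 : ℝ))]
  refine IntegrableOn.union ?_ ?_
  · refine (integrableOn_exp_mul_Iic hε 0).congr_fun (fun t ht => ?_) measurableSet_Iic
    simp [abs_of_nonpos (mem_Iic.1 ht)]
  · refine (integrableOn_exp_mul_Ioi (neg_neg_of_pos hε) 0).congr_fun (fun t ht => ?_)
      measurableSet_Ioi
    simp [abs_of_pos (mem_Ioi.1 ht)]

lemma norm_exp_neg_mul_le {w : ℂ} {R η : ℝ} (hR : |w.re| ≤ R) (hη : |w.im| ≤ η) (c t : ℝ) :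
    ‖Complex.exp (-(2 * Real.pi * w * (c + t * Complex.I)))‖ ≤
      Real.exp (2 * Real.pi * R * |c|) * Real.exp (2 * Real.pi * η * |t|) := by
  rw [Complex.norm_exp, ← Real.exp_add, Real.exp_le_exp]
  have e : (-(2 * Real.pi * w * (c + t * Complex.I))).re =
      2 * Real.pi * (-(w.re * c) + w.im * t) := by
    simp
    ring
  have h1 : -(w.re * c) ≤ R * |c| := by
    refine (neg_le_abs _).trans ?_
    rw [abs_mul]
    gcongr
  have h2 : w.im * t ≤ η * |t| := by
    refine (le_abs_self _).trans ?_
    rw [abs_mul]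
    gcongr
  rw [e]
  calc 2 * Real.pi * (-(w.re * c) + w.im * t) ≤ 2 * Real.pi * (R * |c| + η * |t|) := by gcongr
    _ = _ := by ring

lemma integrable_and_differentiableAt_integral_mul_exp {f : ℝ → ℂ} (hf : Continuous f)
    {C κ : ℝ} (hC : ∀ t, ‖f t‖ ≤ C * Real.exp (-(κ * |t|))) (c : ℝ) {w : ℂ}
    (hw : 2 * Real.pi * |w.im| < κ) :
    Integrable (fun t : ℝ => f t * Complex.exp (-(2 * Real.pi * w * (c + t * Complex.I)))) ∧
    DifferentiableAt ℂ (fun w : ℂ =>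
      ∫ t : ℝ, f t * Complex.exp (-(2 * Real.pi * w * (c + t * Complex.I)))) w := by
  have hC0 : 0 ≤ C := by
    have := (norm_nonneg _).trans (hC 0)
    simpa using this
  obtain ⟨η, hη, hηκ⟩ : ∃ η, |w.im| < η ∧ 2 * Real.pi * η < κ := by
    have hpi := Real.two_pi_pos
    obtain ⟨η, h1, h2⟩ := exists_between ((lt_div_iff₀' hpi).2 hw)
    exact ⟨η, h1, (lt_div_iff₀' hpi).1 h2⟩
  obtain ⟨ε, hε, hεκ⟩ : ∃ ε, 0 < ε ∧ 2 * Real.pi * η + 2 * ε = κ :=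
    ⟨(κ - 2 * Real.pi * η) / 2, by linarith, by ring⟩
  set R := |w.re| + 1 with hR
  have hbound : ∀ z : ℂ, |z.re| < R → |z.im| < η → ∀ t : ℝ,
      ‖f t * Complex.exp (-(2 * Real.pi * z * (c + t * Complex.I)))‖ ≤
        C * Real.exp (2 * Real.pi * R * |c|) * Real.exp (-(2 * ε * |t|)) := by
    intro z hz1 hz2 t
    rw [norm_mul]
    calc _ ≤ (C * Real.exp (-(κ * |t|))) *
          (Real.exp (2 * Real.pi * R * |c|) * Real.exp (2 * Real.pi * η * |t|)) := by
          gcongr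
          · exact hC t
          · exact norm_exp_neg_mul_le hz1.le hz2.le c t
      _ = C * Real.exp (2 * Real.pi * R * |c|) *
          (Real.exp (-(κ * |t|)) * Real.exp (2 * Real.pi * η * |t|)) := by ring
      _ = _ := by
          rw [← Real.exp_add, ← hεκ]
          congr 2
          ring
  have hcont : ∀ z : ℂ, Continuous fun t : ℝ =>
      f t * Complex.exp (-(2 * Real.pi * z * (c + t * Complex.I))) :=
    fun z => hf.mul (by fun_prop)
  have hInt : Integrable fun t : ℝ =>
      f t * Complex.exp (-(2 * Real.pi * w * (c + t * Complex.I))) :=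
    ((integrable_exp_neg_mul_abs (by positivity : 0 < 2 * ε)).const_mul _).mono'
      (hcont w).aestronglyMeasurable (ae_of_all _ (hbound w (by simp [hR]) hη))
  refine ⟨hInt, ?_⟩
  have hnhds : {z : ℂ | |z.re| < R ∧ |z.im| < η} ∈ nhds w := by
    have h1 : IsOpen {z : ℂ | |z.re| < R} :=
      isOpen_lt Complex.continuous_re.abs continuous_const
    have h2 : IsOpen {z : ℂ | |z.im| < η} :=
      isOpen_lt Complex.continuous_im.abs continuous_const
    exact (h1.inter h2).mem_nhds ⟨by simp [hR], hη⟩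
  have hlin : ∀ t : ℝ, ‖-(2 * Real.pi * (c + t * Complex.I))‖ ≤
      2 * Real.pi * (|c| + 1 / ε) * Real.exp (ε * |t|) := by
    intro t
    have h1 : ‖(c : ℂ) + t * Complex.I‖ ≤ |c| + |t| := by
      refine (norm_add_le _ _).trans ?_
      simp
    have h2 : 1 ≤ Real.exp (ε * |t|) := Real.one_le_exp (by positivity)
    have h3 : |t| ≤ 1 / ε * Real.exp (ε * |t|) := by
      rw [one_div, inv_mul_eq_div, le_div_iff₀' hε]
      linarith [Real.add_one_le_exp (ε * |t|)]
    have h4 : |c| ≤ |c| * Real.exp (ε * |t|) := le_mul_of_one_le_right (abs_nonneg c) h2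
    rw [norm_neg, norm_mul, norm_mul, Complex.norm_ofNat, Complex.norm_real,
      Real.norm_of_nonneg Real.pi_pos.le, mul_assoc _ (|c| + 1 / ε)]
    gcongr
    linarith
  refine (hasDerivAt_integral_of_dominated_loc_of_deriv_le
    (F' := fun z t => -(2 * Real.pi * (c + t * Complex.I)) *
      (f t * Complex.exp (-(2 * Real.pi * z * (c + t * Complex.I)))))
    (bound := fun t => 2 * Real.pi * (|c| + 1 / ε) * (C * Real.exp (2 * Real.pi * R * |c|)) *
      Real.exp (-(ε * |t|)))
    hnhds (.of_forall fun z => (hcont z).aestronglyMeasurable) hInt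
    (Continuous.aestronglyMeasurable (by
      refine Continuous.mul (by fun_prop) (hcont w)))
    (ae_of_all _ fun t z hz => ?_) ((integrable_exp_neg_mul_abs hε).const_mul _)
    (ae_of_all _ fun t z _ => ?_)).2.differentiableAt
  · rw [norm_mul]
    calc _ ≤ (2 * Real.pi * (|c| + 1 / ε) * Real.exp (ε * |t|)) *
          (C * Real.exp (2 * Real.pi * R * |c|) * Real.exp (-(2 * ε * |t|))) := by
          gcongr
          · exact hlin t
          · exact hbound z hz.1 hz.2 t
      _ = 2 * Real.pi * (|c| + 1 / ε) * (C * Real.exp (2 * Real.pi * R * |c|)) *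
          (Real.exp (ε * |t|) * Real.exp (-(2 * ε * |t|))) := by ring
      _ = _ := by
          rw [← Real.exp_add]
          congr 2
          ring
  · have h1 : HasDerivAt (fun z : ℂ => -(2 * Real.pi * z * (c + t * Complex.I)))
        (-(2 * Real.pi * (c + t * Complex.I))) z := by
      exact ((((hasDerivAt_id z).const_mul (2 * Real.pi : ℂ)).mul_const
        (c + t * Complex.I)).neg).congr_deriv (by simp)
    exact (h1.cexp.const_mul (f t)).congr_deriv (by ring)

theorem Kfun_strip_analytic (τ : ℝ) (hτ : 0 < τ) (m n : ℕ) {p : ℕ}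
    (hm : m ≤ p) (hn : n ≤ p) (a b : Fin p → ℂ)
    (hN : paramN m n p p = 0) (hμ : paramMu m n a b = 0)
    (hν : (paramNu a b).re < 0)
    (c : ℝ)
    (hc1 : ∀ j : Fin p, m ≤ (j : ℕ) → (b j).re - τ - 1 < c)
    (hc2 : ∀ k : Fin p, n ≤ (k : ℕ) → c < (a k).re) :
    (∀ w : ℂ, |w.im| < -(paramNu a b).re / (4 * τ) →
      MeasureTheory.Integrable (fun t : ℝ =>
        (calG m n a b (c + t * Complex.I) (τ : ℂ) *
          Complex.exp ((Real.pi : ℂ) * (0 : ℂ) / (τ : ℂ) * (c + t * Complex.I) ^ 2) *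
          Complex.exp (-(2 * Real.pi * w * (c + t * Complex.I)))) * Complex.I)) ∧
    DifferentiableOn ℂ (fun w : ℂ => Kfun m n a b (τ : ℂ) (0 : ℂ) c w)
      {w : ℂ | |w.im| < -(paramNu a b).re / (4 * τ)} := by
  have key : ∀ w : ℂ, |w.im| < -(paramNu a b).re / (4 * τ) →
      Integrable (fun t : ℝ => calG m n a b (c + t * Complex.I) τ *
        Complex.exp (-(2 * Real.pi * w * (c + t * Complex.I)))) ∧
      DifferentiableAt ℂ (fun w : ℂ => ∫ t : ℝ, calG m n a b (c + t * Complex.I) τ *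
        Complex.exp (-(2 * Real.pi * w * (c + t * Complex.I)))) w := by
    intro w hw
    obtain ⟨κ, h1, h2⟩ := exists_between (mul_lt_mul_of_pos_left hw Real.two_pi_pos)
    obtain ⟨C, hC⟩ := exists_norm_calG_le hτ hm hn hN hμ hc1 hc2 h2
    exact integrable_and_differentiableAt_integral_mul_exp
      (continuous_calG_line hτ m n a b c hc1 hc2) hC c h1
  refine ⟨fun w hw => ?_, fun w hw => ?_⟩
  · simpa using (key w hw).1.mul_const Complex.I
  · unfold Kfun
    simp only [mul_zero, zero_div, zero_mul, Complex.exp_zero, mul_one, integral_mul_const]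
    exact (((key w hw).2.mul_const _).const_mul _).differentiableWithinAt
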